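/- Consider the Gaussian regression model Y_i = f(X_i) + ε_i, i = 1, …, n, with ε_1, …, ε_n i.i.d. standard Gaussian and an arbitrary (deterministic or random) design X_1, …, X_n ∈ [0,1]^d. Assume L ≥ 1 and 1 ≤ d* < d. Fix α with 0 < α < (log 3 − log 2)/log 3 and suppose that d* (log d − log d*) / n ≥ 1/α. Then there is a constant c > 0 (depending only on α) such that every estimator J̃ (i.e., every measurable function of the data with values in the subsets of {1,…,d}) satisfies sup_{f ∈ Σ̃_L} P_f( J̃ ≠ J_f ) ≥ c. -/

import Mathlib

open Real Set MeasureTheory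
open scoped Classical

/-- The unit cube `[0,1]^d`. -/
def unitBox (d : ℕ) : Set (Fin d → ℝ) := Set.univ.pi fun _ => Set.Icc (0 : ℝ) 1

/-- `k ∈ (ℤ^d)₊` : the first nonzero coordinate of `k` is positive. -/
def PosLex {d : ℕ} (k : Fin d → ℤ) : Prop :=
  ∃ j : Fin d, 0 < k j ∧ ∀ i : Fin d, i < j → k i = 0

/-- The Fourier basis on `[0,1]^d`: `φ_k(x) = 1` if `k = 0`,
`√2 cos(2π k·x)` if `k ∈ (ℤ^d)₊`, and `√2 sin(2π k·x)` if `−k ∈ (ℤ^d)₊`. -/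
noncomputable def phiF {d : ℕ} (k : Fin d → ℤ) (x : Fin d → ℝ) : ℝ :=
  if k = 0 then 1
  else if PosLex k then Real.sqrt 2 * Real.cos (2 * Real.pi * ∑ i, (k i : ℝ) * x i)
  else Real.sqrt 2 * Real.sin (2 * Real.pi * ∑ i, (k i : ℝ) * x i)

/-- The Fourier coefficient `θ_k[f] = ∫_{[0,1]^d} f(x) φ_k(x) dx`. -/
noncomputable def thetaCoef {d : ℕ} (f : (Fin d → ℝ) → ℝ) (k : Fin d → ℤ) : ℝ :=
  ∫ x in unitBox d, f x * phiF k x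

/-- `Q_j[f] = Σ_{k ∈ ℤ^d : k_j ≠ 0} θ_k[f]²`. -/
noncomputable def Qcoef {d : ℕ} (f : (Fin d → ℝ) → ℝ) (j : Fin d) : ℝ :=
  ∑' k : {k : Fin d → ℤ // k j ≠ 0}, thetaCoef f (k : Fin d → ℤ) ^ 2

/-- Membership in the smoothness class `Σ_L`:
for every `j`, `Σ_{k ∈ ℤ^d} k_j² θ_k[f]²` is finite and `≤ L`. -/
def memSigmaL {d : ℕ} (L : ℝ) (f : (Fin d → ℝ) → ℝ) : Prop :=
  ∀ j : Fin d, (Summable fun k : Fin d → ℤ => ((k j : ℝ)) ^ 2 * thetaCoef f k ^ 2) ∧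
    ∑' k : Fin d → ℤ, ((k j : ℝ)) ^ 2 * thetaCoef f k ^ 2 ≤ L

/-- The sparsity pattern `J_f = {j : Q_j[f] ≠ 0}` of a regression function `f`. -/
def sparsityPattern {d : ℕ} (f : (Fin d → ℝ) → ℝ) : Set (Fin d) :=
  {j : Fin d | Qcoef f j ≠ 0}

/-- Membership in the class `Σ̃_L` (with `κ = 1`): `f ∈ Σ_L`, the sparsity pattern `J_f`
has at most `d*` elements, `f` depends only on the coordinates in `J_f`, and
`Q_j[f] ≥ 1` for every `j ∈ J_f`. -/
def memTildeSigma {d : ℕ} (dstar : ℕ) (L : ℝ) (f : (Fin d → ℝ) → ℝ) : Prop :=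
  memSigmaL L f ∧ (sparsityPattern f).ncard ≤ dstar ∧
    (∀ x y : Fin d → ℝ, (∀ j ∈ sparsityPattern f, x j = y j) → f x = f y) ∧
    ∀ j ∈ sparsityPattern f, 1 ≤ Qcoef f j

/-- The standard Gaussian density `φ(t) = (2π)^{-1/2} e^{−t²/2}`. -/
noncomputable def gaussD (t : ℝ) : ℝ := (Real.sqrt (2 * Real.pi))⁻¹ * Real.exp (-(t ^ 2) / 2)

/-- `P_f`, the distribution on `ℝⁿ` of the observations `Y_i = f(X_i) + ε_i`,
`i = 1, …, n`, with i.i.d. standard Gaussian noise and fixed design `X`: the measure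
with density `y ↦ Π_i φ(y_i − f(X_i))` with respect to the Lebesgue measure. -/
noncomputable def Pf {d n : ℕ} (X : Fin n → Fin d → ℝ) (f : (Fin d → ℝ) → ℝ) :
    MeasureTheory.Measure (Fin n → ℝ) :=
  MeasureTheory.volume.withDensity
    (fun y => ENNReal.ofReal (∏ i, gaussD (y i - f (X i))))

/-- `n^k / k^k` bounds the binomial coefficient from below. -/
lemma div_pow_self_le_choose (k n : ℕ) (h : k ≤ n) :
    ((n : ℝ) / k) ^ k ≤ (n.choose k : ℝ) := by
  induction k generalizing n with
  | zero => simp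
  | succ k ih =>
    obtain ⟨m, rfl⟩ : ∃ m, n = m + 1 := ⟨n - 1, by omega⟩
    have hkm : k ≤ m := by omega
    have hpascal : ((m + 1).choose (k + 1) : ℝ) = ((m : ℝ) + 1) / (k + 1) * m.choose k := by
      have := Nat.add_one_mul_choose_eq m k
      have h' : ((m : ℝ) + 1) * m.choose k = (m + 1).choose (k + 1) * ((k : ℝ) + 1) := by
        exact_mod_cast this
      field_simp
      linarith
    have hpow : (((m : ℝ) + 1) / (k + 1)) ^ k ≤ ((m : ℝ) / k) ^ k := by
      rcases Nat.eq_zero_or_pos k with rfl | hk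
      · simp
      · have hk' : (0 : ℝ) < k := by exact_mod_cast hk
        have hkm' : (k : ℝ) ≤ m := by exact_mod_cast hkm
        refine pow_le_pow_left₀ (by positivity) ?_ _
        rw [div_le_div_iff₀ (by positivity) hk']
        nlinarith
    push_cast
    rw [hpascal, pow_succ, mul_comm]
    exact mul_le_mul_of_nonneg_left (hpow.trans (ih m hkm)) (by positivity)

/-! ### Orthogonality of the trigonometric system -/

lemma integral_cexp_unit_interval (m : ℤ) :
    ∫ x in Set.Icc (0 : ℝ) 1, Complex.exp (2 * π * Complex.I * m * x) =
      if m = 0 then 1 else 0 := by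
  rw [integral_Icc_eq_integral_Ioc, ← intervalIntegral.integral_of_le zero_le_one]
  split_ifs with h
  · simp [h]
  · have hc : (2 * π * Complex.I * m : ℂ) ≠ 0 := by
      simp [h, Real.pi_ne_zero, Complex.I_ne_zero]
    rw [integral_exp_mul_complex hc]
    have : Complex.exp (2 * π * Complex.I * m) = 1 := by
      rw [mul_comm]; exact Complex.exp_int_mul_two_pi_mul_I m
    simp [this]

lemma integral_cexp_unitBox {d : ℕ} (m : Fin d → ℤ) :
    ∫ x in unitBox d, Complex.exp (((2 * π * ∑ i, (m i : ℝ) * x i : ℝ) : ℂ) * Complex.I) =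
      if m = 0 then 1 else 0 := by
  have hexp : ∀ x : Fin d → ℝ,
      Complex.exp (((2 * π * ∑ i, (m i : ℝ) * x i : ℝ) : ℂ) * Complex.I) =
        ∏ i, Complex.exp (2 * π * Complex.I * m i * x i) := by
    intro x
    rw [← Complex.exp_sum]
    congr 1
    push_cast
    rw [Finset.mul_sum, Finset.sum_mul]
    exact Finset.sum_congr rfl fun i _ => by ring
  simp_rw [hexp]
  rw [unitBox, volume_pi, Measure.restrict_pi_pi,
    integral_fintype_prod_eq_prod (fun i (t : ℝ) => Complex.exp (2 * π * Complex.I * m i * t))]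
  simp_rw [integral_cexp_unit_interval]
  split_ifs with h
  · simp [h]
  · obtain ⟨i, hi⟩ := Function.ne_iff.mp h
    exact Finset.prod_eq_zero (Finset.mem_univ i) (if_neg hi)

lemma isCompact_unitBox (d : ℕ) : IsCompact (unitBox d) :=
  isCompact_univ_pi fun _ => isCompact_Icc

lemma integrableOn_unitBox {d : ℕ} {E : Type*} [NormedAddCommGroup E] {f : (Fin d → ℝ) → E}
    (hf : Continuous f) : IntegrableOn f (unitBox d) :=
  hf.continuousOn.integrableOn_compact (isCompact_unitBox d)

lemma integral_cos_unitBox {d : ℕ} (m : Fin d → ℤ) :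
    ∫ x in unitBox d, Real.cos (2 * π * ∑ i, (m i : ℝ) * x i) = if m = 0 then 1 else 0 := by
  have h := integral_re (𝕜 := ℂ) (integrableOn_unitBox (d := d)
    (f := fun x => Complex.exp (((2 * π * ∑ i, (m i : ℝ) * x i : ℝ) : ℂ) * Complex.I))
    (by fun_prop))
  rw [integral_cexp_unitBox] at h
  simp only [RCLike.re_eq_complex_re, Complex.exp_ofReal_mul_I_re] at h
  rw [h]
  split_ifs <;> simp

lemma integral_sin_unitBox {d : ℕ} (m : Fin d → ℤ) :
    ∫ x in unitBox d, Real.sin (2 * π * ∑ i, (m i : ℝ) * x i) = 0 := by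
  have h := integral_im (𝕜 := ℂ) (integrableOn_unitBox (d := d)
    (f := fun x => Complex.exp (((2 * π * ∑ i, (m i : ℝ) * x i : ℝ) : ℂ) * Complex.I))
    (by fun_prop))
  rw [integral_cexp_unitBox] at h
  simp only [RCLike.im_eq_complex_im, Complex.exp_ofReal_mul_I_im] at h
  rw [h]
  split_ifs <;> simp

lemma PosLex.ne_zero {d : ℕ} {k : Fin d → ℤ} (hk : PosLex k) : k ≠ 0 := by
  rintro rfl
  obtain ⟨j, hj, -⟩ := hk
  simp at hj

lemma PosLex.add_ne_zero {d : ℕ} {k m : Fin d → ℤ} (hk : PosLex k) (hm : PosLex m) :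
    k + m ≠ 0 := by
  intro h
  obtain ⟨i, hi, hi'⟩ := hk
  obtain ⟨j, hj, hj'⟩ := hm
  have hsum : ∀ l, k l + m l = 0 := fun l => congrFun h l
  rcases lt_trichotomy i j with hij | rfl | hij
  · have := hj' i hij; have := hsum i; omega
  · have := hsum i; omega
  · have := hi' j hij; have := hsum j; omega

/-- A cosine of the Fourier basis is orthonormal to the rest of the basis. -/
lemma thetaCoef_phiF {d : ℕ} {k : Fin d → ℤ} (hk : PosLex k) (m : Fin d → ℤ) :
    thetaCoef (phiF k) m = if m = k then 1 else 0 := by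
  have hadd : ∀ x : Fin d → ℝ, 2 * π * ∑ i, (((m + k) i : ℤ) : ℝ) * x i =
      2 * π * ∑ i, (m i : ℝ) * x i + 2 * π * ∑ i, (k i : ℝ) * x i := by
    intro x
    simp only [Pi.add_apply, Int.cast_add, add_mul, Finset.sum_add_distrib, mul_add]
  have hsub : ∀ x : Fin d → ℝ, 2 * π * ∑ i, (((m - k) i : ℤ) : ℝ) * x i =
      2 * π * ∑ i, (m i : ℝ) * x i - 2 * π * ∑ i, (k i : ℝ) * x i := by
    intro x
    simp only [Pi.sub_apply, Int.cast_sub, sub_mul, Finset.sum_sub_distrib, mul_sub]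
  have hsqrt : Real.sqrt 2 * Real.sqrt 2 = 2 := Real.mul_self_sqrt (by norm_num)
  unfold thetaCoef
  by_cases hm0 : m = 0
  · subst hm0
    rw [if_neg hk.ne_zero.symm]
    simp only [phiF, if_neg hk.ne_zero, if_pos hk, if_true, mul_one]
    rw [integral_const_mul, integral_cos_unitBox, if_neg hk.ne_zero, mul_zero]
  by_cases hm : PosLex m
  · have hprod : ∀ x, phiF k x * phiF m x =
        Real.cos (2 * π * ∑ i, (((m + k) i : ℤ) : ℝ) * x i) +
          Real.cos (2 * π * ∑ i, (((m - k) i : ℤ) : ℝ) * x i) := by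
      intro x
      simp only [phiF, if_neg hk.ne_zero, if_pos hk, if_neg hm0, if_pos hm]
      rw [hadd, hsub, Real.cos_add, Real.cos_sub]
      linear_combination (Real.cos (2 * π * ∑ i, (k i : ℝ) * x i) *
        Real.cos (2 * π * ∑ i, (m i : ℝ) * x i)) * hsqrt
    simp_rw [hprod]
    rw [integral_add (integrableOn_unitBox (by fun_prop)) (integrableOn_unitBox (by fun_prop)),
      integral_cos_unitBox, integral_cos_unitBox, if_neg (hm.add_ne_zero hk), zero_add]
    simp only [sub_eq_zero]
  · have hprod : ∀ x, phiF k x * phiF m x =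
        Real.sin (2 * π * ∑ i, (((m + k) i : ℤ) : ℝ) * x i) +
          Real.sin (2 * π * ∑ i, (((m - k) i : ℤ) : ℝ) * x i) := by
      intro x
      simp only [phiF, if_neg hk.ne_zero, if_pos hk, if_neg hm0, if_neg hm]
      rw [hadd, hsub, Real.sin_add, Real.sin_sub]
      linear_combination (Real.cos (2 * π * ∑ i, (k i : ℝ) * x i) *
        Real.sin (2 * π * ∑ i, (m i : ℝ) * x i)) * hsqrt
    simp_rw [hprod]
    rw [integral_add (integrableOn_unitBox (by fun_prop)) (integrableOn_unitBox (by fun_prop)),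
      integral_sin_unitBox, integral_sin_unitBox, add_zero, if_neg]
    rintro rfl
    exact hm hk

/-! ### The family of hypotheses -/

/-- The frequency vector with entries `1` on `J` and `0` elsewhere. -/
def indicatorFreq {d : ℕ} (J : Finset (Fin d)) : Fin d → ℤ := fun j => if j ∈ J then 1 else 0

lemma posLex_indicatorFreq {d : ℕ} {J : Finset (Fin d)} (hJ : J.Nonempty) :
    PosLex (indicatorFreq J) := by
  refine ⟨J.min' hJ, ?_, fun i hi => ?_⟩
  · simp [indicatorFreq, J.min'_mem hJ]
  · exact if_neg fun hiJ => absurd (J.min'_le i hiJ) (not_le.mpr hi)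

lemma Qcoef_phiF {d : ℕ} {k : Fin d → ℤ} (hk : PosLex k) (j : Fin d) :
    Qcoef (phiF k) j = if k j ≠ 0 then 1 else 0 := by
  unfold Qcoef
  simp_rw [thetaCoef_phiF hk]
  split_ifs with h
  · rw [tsum_eq_single (⟨k, h⟩ : {m : Fin d → ℤ // m j ≠ 0})]
    · simp
    · intro m hm
      rw [if_neg fun h' => hm (Subtype.ext h'), zero_pow two_ne_zero]
  · refine (tsum_congr fun m => ?_).trans tsum_zero
    rw [if_neg, zero_pow two_ne_zero]
    intro h'
    exact h (h' ▸ m.2)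

lemma sparsityPattern_phiF_indicatorFreq {d : ℕ} {J : Finset (Fin d)} (hJ : J.Nonempty) :
    sparsityPattern (phiF (indicatorFreq J)) = (J : Set (Fin d)) := by
  ext j
  simp [sparsityPattern, Qcoef_phiF (posLex_indicatorFreq hJ), indicatorFreq]

lemma memTildeSigma_phiF_indicatorFreq {d dstar : ℕ} {L : ℝ} (hL : 1 ≤ L)
    {J : Finset (Fin d)} (hJ : J.Nonempty) (hcard : J.card ≤ dstar) :
    memTildeSigma dstar L (phiF (indicatorFreq J)) := by
  have hpos := posLex_indicatorFreq hJ
  refine ⟨fun j => ?_, ?_, fun x y hxy => ?_, fun j hj => ?_⟩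
  · have hterm : HasSum (fun k : Fin d → ℤ =>
        ((k j : ℝ)) ^ 2 * thetaCoef (phiF (indicatorFreq J)) k ^ 2)
        ((indicatorFreq J j : ℝ) ^ 2 *
          thetaCoef (phiF (indicatorFreq J)) (indicatorFreq J) ^ 2) := by
      refine hasSum_single _ fun k hk => ?_
      rw [thetaCoef_phiF hpos, if_neg hk]
      ring
    refine ⟨hterm.summable, hterm.tsum_eq.trans_le (le_trans ?_ hL)⟩
    rw [thetaCoef_phiF hpos, if_pos rfl]
    by_cases hjJ : j ∈ J <;> simp [indicatorFreq, hjJ]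
  · rw [sparsityPattern_phiF_indicatorFreq hJ, Set.ncard_coe_finset]
    exact hcard
  · rw [sparsityPattern_phiF_indicatorFreq hJ] at hxy
    have hsum : ∑ i, (indicatorFreq J i : ℝ) * x i = ∑ i, (indicatorFreq J i : ℝ) * y i := by
      refine Finset.sum_congr rfl fun i _ => ?_
      by_cases hi : i ∈ J
      · rw [hxy i hi]
      · simp [indicatorFreq, hi]
    simp only [phiF, hsum]
  · rw [sparsityPattern_phiF_indicatorFreq hJ] at hj
    rw [Qcoef_phiF hpos, if_pos]
    simpa [indicatorFreq] using hj

lemma phiF_sq_le_two {d : ℕ} (k : Fin d → ℤ) (x : Fin d → ℝ) : phiF k x ^ 2 ≤ 2 := by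
  have hsqrt : Real.sqrt 2 ^ 2 = 2 := Real.sq_sqrt (by norm_num)
  unfold phiF
  split_ifs
  · norm_num
  · rw [mul_pow, hsqrt]
    linarith [Real.cos_sq_le_one (2 * π * ∑ i, (k i : ℝ) * x i)]
  · rw [mul_pow, hsqrt]
    linarith [Real.sin_sq_le_one (2 * π * ∑ i, (k i : ℝ) * x i)]

/-! ### Gaussian shifts -/

/-- The distribution `N(a, I)` on `ℝⁿ`. -/
noncomputable def gaussShift {n : ℕ} (a : Fin n → ℝ) : Measure (Fin n → ℝ) :=
  volume.withDensity fun y => ENNReal.ofReal (∏ i, gaussD (y i - a i))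

lemma gaussD_nonneg (t : ℝ) : 0 ≤ gaussD t := by
  unfold gaussD
  positivity

lemma continuous_gaussD : Continuous gaussD := by
  unfold gaussD
  fun_prop

lemma gaussD_sub_eq_gaussianPDFReal (a t : ℝ) :
    gaussD (t - a) = ProbabilityTheory.gaussianPDFReal a 1 t := by
  simp [gaussD, ProbabilityTheory.gaussianPDFReal]

lemma gaussD_sub_sq (a t : ℝ) :
    gaussD (t - a) ^ 2 = Real.exp (a ^ 2) * gaussD (t - 2 * a) * gaussD t := by
  unfold gaussD
  have hexp : Real.exp (-((t - a) ^ 2) / 2) ^ 2 =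
      Real.exp (a ^ 2) * Real.exp (-((t - 2 * a) ^ 2) / 2) * Real.exp (-(t ^ 2) / 2) := by
    rw [sq, ← Real.exp_add, ← Real.exp_add, ← Real.exp_add]
    congr 1
    ring
  rw [mul_pow, hexp]
  ring

instance isProbabilityMeasure_gaussShift {n : ℕ} (a : Fin n → ℝ) :
    IsProbabilityMeasure (gaussShift a) := by
  constructor
  rw [gaussShift, withDensity_apply _ MeasurableSet.univ, Measure.restrict_univ,
    ← ofReal_integral_eq_lintegral_ofReal]
  · rw [integral_fintype_prod_volume_eq_prod (fun i (t : ℝ) => gaussD (t - a i))]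
    simp [gaussD_sub_eq_gaussianPDFReal, ProbabilityTheory.integral_gaussianPDFReal_eq_one]
  · refine Integrable.fintype_prod (f := fun i (t : ℝ) => gaussD (t - a i)) fun i => ?_
    simp_rw [gaussD_sub_eq_gaussianPDFReal]
    exact ProbabilityTheory.integrable_gaussianPDFReal _ _
  · exact Filter.Eventually.of_forall fun y => Finset.prod_nonneg fun i _ => gaussD_nonneg _

/-- The likelihood of `N(a, I)` is controlled by the second moment of the likelihood ratio
with respect to `N(0, I)`. -/
lemma prod_gaussD_sub_le {n : ℕ} (a : Fin n → ℝ) {B t : ℝ} (hB : ∑ i, a i ^ 2 ≤ B)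
    (ht : 0 < t) (y : Fin n → ℝ) :
    ∏ i, gaussD (y i - a i) ≤ t / 2 * Real.exp B * ∏ i, gaussD (y i - 2 * a i) +
      1 / (2 * t) * ∏ i, gaussD (y i - 0) := by
  have hsq : (∏ i, gaussD (y i - a i)) ^ 2 =
      Real.exp (∑ i, a i ^ 2) * (∏ i, gaussD (y i - 2 * a i)) * ∏ i, gaussD (y i - 0) := by
    rw [← Finset.prod_pow, Real.exp_sum, ← Finset.prod_mul_distrib, ← Finset.prod_mul_distrib]
    exact Finset.prod_congr rfl fun i _ => by rw [gaussD_sub_sq, sub_zero]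
  have hu : 0 ≤ ∏ i, gaussD (y i - 2 * a i) := Finset.prod_nonneg fun i _ => gaussD_nonneg _
  have hv : 0 ≤ ∏ i, gaussD (y i - 0) := Finset.prod_nonneg fun i _ => gaussD_nonneg _
  set p := ∏ i, gaussD (y i - a i)
  set u := ∏ i, gaussD (y i - 2 * a i)
  set v := ∏ i, gaussD (y i - 0)
  have hle : p ^ 2 ≤ Real.exp B * u * v := by
    rw [hsq]
    gcongr
  have hA : 0 ≤ t * (Real.exp B * u) := by positivity
  have hC : 0 ≤ v / t := by positivity
  have hAC : t * (Real.exp B * u) * (v / t) = Real.exp B * u * v := by field_simp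
  have hsum : t / 2 * Real.exp B * u + 1 / (2 * t) * v =
      (t * (Real.exp B * u) + v / t) / 2 := by field_simp
  rw [hsum]
  refine abs_le_of_sq_le_sq' ?_ (by positivity) |>.2
  nlinarith [sq_nonneg (t * (Real.exp B * u) - v / t)]

lemma gaussShift_real_le {n : ℕ} (a : Fin n → ℝ) {B t : ℝ} (hB : ∑ i, a i ^ 2 ≤ B)
    (ht : 0 < t) {D : Set (Fin n → ℝ)} (hD : MeasurableSet D) :
    (gaussShift a).real D ≤ t / 2 * Real.exp B + 1 / (2 * t) * (gaussShift 0).real D := by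
  have hmeas : ∀ b : Fin n → ℝ,
      Measurable fun y : Fin n → ℝ => ENNReal.ofReal (∏ i, gaussD (y i - b i)) := fun b =>
    ENNReal.measurable_ofReal.comp (Finset.measurable_prod _ fun i _ =>
      continuous_gaussD.measurable.comp ((measurable_pi_apply i).sub_const _))
  have hle : gaussShift a D ≤
      ENNReal.ofReal (t / 2 * Real.exp B) * gaussShift (fun i => 2 * a i) D +
        ENNReal.ofReal (1 / (2 * t)) * gaussShift 0 D := by
    simp only [gaussShift, withDensity_apply _ hD]
    rw [← lintegral_const_mul _ (hmeas _), ← lintegral_const_mul _ (hmeas _),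
      ← lintegral_add_left ((hmeas _).const_mul _)]
    refine lintegral_mono fun y => ?_
    rw [← ENNReal.ofReal_mul (by positivity), ← ENNReal.ofReal_mul (by positivity),
      ← ENNReal.ofReal_add
        (mul_nonneg (by positivity) (Finset.prod_nonneg fun i _ => gaussD_nonneg _))
        (mul_nonneg (by positivity) (Finset.prod_nonneg fun i _ => gaussD_nonneg _))]
    exact ENNReal.ofReal_le_ofReal (prod_gaussD_sub_le a hB ht y)
  have hreal := ENNReal.toReal_mono (by finiteness) hle
  rw [ENNReal.toReal_add (by finiteness) (by finiteness), ENNReal.toReal_mul, ENNReal.toReal_mul,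
    ENNReal.toReal_ofReal (by positivity), ENNReal.toReal_ofReal (by positivity)] at hreal
  refine hreal.trans (add_le_add_left ?_ _)
  exact mul_le_of_le_one_right (by positivity) (measureReal_le_one (μ := gaussShift _) (s := D))

/-- Among `M ≥ e^B / q²` Gaussian shifts of squared size at most `B`, any family of disjoint
decision regions has a member whose success probability is at most `q`. -/
lemma exists_gaussShift_real_le {n : ℕ} {ι : Type*} (s : Finset ι) (a : ι → Fin n → ℝ)
    {B q : ℝ} (hB : ∀ J ∈ s, ∑ i, a J i ^ 2 ≤ B) (hq : 0 < q)
    (hcard : Real.exp B ≤ q ^ 2 * s.card) (D : ι → Set (Fin n → ℝ))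
    (hD : ∀ J ∈ s, MeasurableSet (D J)) (hdisj : (s : Set ι).PairwiseDisjoint D) :
    ∃ J ∈ s, (gaussShift (a J)).real (D J) ≤ q := by
  by_contra! hcon
  have hs : s.Nonempty := by
    rw [Finset.nonempty_iff_ne_empty]
    rintro rfl
    simp only [Finset.card_empty, Nat.cast_zero, mul_zero] at hcard
    exact absurd hcard (not_le.mpr (Real.exp_pos B))
  have hE : 0 < Real.exp B := Real.exp_pos B
  have hsum : ∑ J ∈ s, (gaussShift 0).real (D J) ≤ 1 := by
    rw [← measureReal_biUnion_finset hdisj hD]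
    exact measureReal_le_one
  have ht : 0 < q / Real.exp B := by positivity
  have hlt : (s.card : ℝ) * q < s.card * (q / Real.exp B / 2 * Real.exp B) +
      1 / (2 * (q / Real.exp B)) * ∑ J ∈ s, (gaussShift 0).real (D J) := by
    calc (s.card : ℝ) * q = ∑ _J ∈ s, q := by simp
      _ < ∑ J ∈ s, (gaussShift (a J)).real (D J) := Finset.sum_lt_sum_of_nonempty hs hcon
      _ ≤ ∑ J ∈ s, (q / Real.exp B / 2 * Real.exp B +
            1 / (2 * (q / Real.exp B)) * (gaussShift 0).real (D J)) :=
          Finset.sum_le_sum fun J hJ => gaussShift_real_le (a J) (hB J hJ) ht (hD J hJ)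
      _ = _ := by rw [Finset.sum_add_distrib, Finset.mul_sum]; simp
  have hlast : 1 / (2 * (q / Real.exp B)) * ∑ J ∈ s, (gaussShift 0).real (D J) ≤
      Real.exp B / (2 * q) := by
    refine (mul_le_of_le_one_right (by positivity) hsum).trans_eq ?_
    field_simp
  have hhalf : Real.exp B / (2 * q) ≤ s.card * q / 2 := by
    rw [div_le_div_iff₀ (by positivity) (by norm_num)]
    nlinarith
  have hsimp : q / Real.exp B / 2 * Real.exp B = q / 2 := by field_simp
  rw [hsimp] at hlt
  linarith

/-- Proposition 2 of the paper. Fix `α ∈ (0, (log 3 − log 2)/log 3)`.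
There is a constant `c > 0` depending only on `α` such that for every Gaussian regression
problem with arbitrary design `X_1, …, X_n ∈ [0,1]^d`, `L ≥ 1`, `1 ≤ d* < d`, and
`d*(log d − log d*)/n ≥ 1/α`, every estimator `J̃ : ℝⁿ → 2^{1,…,d}` satisfies
`sup_{f ∈ Σ̃_L} P_f(J̃ ≠ J_f) ≥ c`. -/
theorem sparsity_pattern_lower_bound (α : ℝ)
    (hα : 0 < α ∧ α < (Real.log 3 - Real.log 2) / Real.log 3) :
    ∃ c : ℝ, 0 < c ∧
      ∀ (d dstar n : ℕ) (L : ℝ) (X : Fin n → Fin d → ℝ),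
        1 ≤ L → 1 ≤ dstar → dstar < d → 0 < n →
        (∀ i, X i ∈ unitBox d) →
        (1 / α : ℝ) ≤ (dstar : ℝ) * (Real.log d - Real.log dstar) / n →
        ∀ Jest : (Fin n → ℝ) → Set (Fin d),
          ∃ f : (Fin d → ℝ) → ℝ, memTildeSigma dstar L f ∧
            ENNReal.ofReal c ≤ Pf X f {y : Fin n → ℝ | Jest y ≠ sparsityPattern f} := by
  obtain ⟨hα0, hα1⟩ := hα
  have hlog3 : 0 < Real.log 3 := Real.log_pos (by norm_num)
  have hhalf : α < 1 / 2 := by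
    have hlog_lt : Real.log 3 < 2 * Real.log 2 := by
      have := Real.log_lt_log (by norm_num) (show (3 : ℝ) < 2 ^ 2 by norm_num)
      rwa [Real.log_pow, Nat.cast_ofNat] at this
    refine hα1.trans ?_
    rw [div_lt_div_iff₀ hlog3 (by norm_num)]
    linarith
  have hinv : 2 < 1 / α := by
    rw [lt_div_iff₀ hα0]
    linarith
  set q : ℝ := Real.exp (-((1 / α - 2) / 2)) with hq
  have hq0 : 0 < q := Real.exp_pos _
  have hq1 : q < 1 := Real.exp_lt_one_iff.mpr (by linarith)
  refine ⟨1 - q, by linarith, ?_⟩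
  intro d dstar n L X hL hds hd hn _ hcond Jest
  by_contra! hcon
  have hn1 : (1 : ℝ) ≤ n := by exact_mod_cast hn
  let s : Finset (Finset (Fin d)) := Finset.powersetCard dstar Finset.univ
  have hmem : ∀ J ∈ s, J.card = dstar := fun J hJ => (Finset.mem_powersetCard.mp hJ).2
  have hne : ∀ J ∈ s, J.Nonempty := fun J hJ =>
    Finset.card_pos.mp (by rw [hmem J hJ]; omega)
  have hscard : Real.exp (n / α) ≤ s.card := by
    have hds0 : (0 : ℝ) < dstar := by exact_mod_cast hds
    have hd0 : (0 : ℝ) < d := by exact_mod_cast (by omega : 0 < d)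
    rw [Finset.card_powersetCard, Finset.card_univ, Fintype.card_fin]
    refine le_trans ?_ (div_pow_self_le_choose dstar d hd.le)
    rw [← Real.exp_log (show 0 < ((d : ℝ) / dstar) ^ dstar by positivity), Real.log_pow,
      Real.log_div hd0.ne' hds0.ne']
    refine Real.exp_le_exp.mpr ?_
    rw [le_div_iff₀ (by linarith)] at hcond
    calc (n : ℝ) / α = 1 / α * n := by ring
      _ ≤ _ := hcond
  have hcard : Real.exp (2 * n) ≤ q ^ 2 * s.card := by
    refine le_trans ?_ (mul_le_mul_of_nonneg_left hscard (by positivity))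
    rw [hq, sq, ← Real.exp_add, ← Real.exp_add]
    refine Real.exp_le_exp.mpr ?_
    have : (n : ℝ) / α = 1 / α * n := by ring
    rw [this]
    nlinarith
  let a : Finset (Fin d) → Fin n → ℝ := fun J i => phiF (indicatorFreq J) (X i)
  let D : Finset (Fin d) → Set (Fin n → ℝ) := fun J =>
    (toMeasurable (gaussShift (a J)) {y | Jest y ≠ (J : Set (Fin d))})ᶜ
  have hDsub : ∀ J, ∀ y ∈ D J, Jest y = J := fun J y hy => by
    by_contra h
    exact hy (subset_toMeasurable _ _ h)
  obtain ⟨J, hJ, hle⟩ := exists_gaussShift_real_le s a (B := 2 * n) (q := q) (fun J _ => by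
      calc ∑ i, a J i ^ 2 ≤ ∑ _i : Fin n, (2 : ℝ) :=
            Finset.sum_le_sum fun i _ => phiF_sq_le_two _ _
        _ = 2 * n := by simp [mul_comm]) hq0 hcard D
    (fun J _ => (measurableSet_toMeasurable _ _).compl)
    (fun J _ K _ hJK => Set.disjoint_left.mpr fun y hyJ hyK =>
      hJK (Finset.coe_injective ((hDsub J y hyJ).symm.trans (hDsub K y hyK))))
  have herr := hcon _ (memTildeSigma_phiF_indicatorFreq hL (hne J hJ) (hmem J hJ).le)
  rw [sparsityPattern_phiF_indicatorFreq (hne J hJ)] at herr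
  change gaussShift (a J) {y | Jest y ≠ (J : Set (Fin d))} < _ at herr
  rw [← measure_toMeasurable, ENNReal.lt_ofReal_iff_toReal_lt (by finiteness)] at herr
  have hcompl := probReal_compl_eq_one_sub (μ := gaussShift (a J))
    (measurableSet_toMeasurable (gaussShift (a J)) {y | Jest y ≠ (J : Set (Fin d))})
  change (gaussShift (a J)).real (D J) = _ at hcompl
  rw [hcompl] at hle
  simp only [measureReal_def] at hle
  linarith
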